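/- Let z ∈ (-1,0] be a real number, p ≥ 2 an integer, and s_1,...,s_k positive integers. Then (a) ∑_{n=1}^∞ ζ_n(s_1,...,s_k; z) / (n+z)^p = ζ(s_1,...,s_{k-1}, s_k + p; z) + ζ(s_1,...,s_k, p; z), and (b) ∑_{n=1}^∞ ζ_n(s_1,...,s_k; z) / (n+1+z)^p = ζ(s_1,...,s_k, p; z). -/

import Mathlib

open scoped BigOperators Classical

/-- The finite multiple Hurwitz zeta value
`ζ_n(s_1,…,s_k; z) = ∑_{1 ≤ n_1 < ⋯ < n_k ≤ n} ∏ 1/(n_i+z)^{s_i}`. -/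
noncomputable def finMZV (z : ℝ) {k : ℕ} (s : Fin k → ℕ) (n : ℕ) : ℝ :=
  ∑ t : Fin k → Fin n, if StrictMono t then ∏ i, 1 / (((t i : ℕ) : ℝ) + 1 + z) ^ (s i) else 0

/-- The multiple Hurwitz zeta value
`ζ(s_1,…,s_k; z) = ∑_{1 ≤ n_1 < ⋯ < n_k} ∏ 1/(n_i+z)^{s_i}`. -/
noncomputable def MZV (z : ℝ) {k : ℕ} (s : Fin k → ℕ) : ℝ :=
  ∑' f : {f : Fin k → ℕ // StrictMono f}, ∏ i, 1 / ((f.1 i : ℝ) + 1 + z) ^ (s i)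

/-- The strictly increasing `k`-tuples of natural numbers less than `N`. -/
noncomputable def strictTuples (k N : ℕ) : Finset (Fin k → ℕ) :=
  (Fintype.piFinset fun _ => Finset.range N).filter StrictMono

lemma mem_strictTuples {k N : ℕ} {f : Fin k → ℕ} :
    f ∈ strictTuples k N ↔ (∀ i, f i < N) ∧ StrictMono f := by
  simp [strictTuples]

lemma finMZV_eq_sum_strictTuples (z : ℝ) {k : ℕ} (s : Fin k → ℕ) (N : ℕ) :
    finMZV z s N = ∑ f ∈ strictTuples k N, ∏ i, 1 / ((f i : ℝ) + 1 + z) ^ (s i) := by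
  unfold finMZV
  rw [← Finset.sum_filter]
  refine Finset.sum_bij (fun t _ i => (t i : ℕ)) ?_ ?_ ?_ ?_
  · intro t ht
    exact mem_strictTuples.2 ⟨fun i => (t i).2, fun i j h => (Finset.mem_filter.1 ht).2 h⟩
  · intro t _ u _ h
    funext i
    exact Fin.ext (congrFun h i)
  · intro f hf
    obtain ⟨hN, hm⟩ := mem_strictTuples.1 hf
    exact ⟨fun i => ⟨f i, hN i⟩, Finset.mem_filter.2 ⟨Finset.mem_univ _, fun i j h => hm h⟩, rfl⟩
  · intro t _
    rfl

lemma finMZV_succ_zero (z : ℝ) {k : ℕ} (s : Fin (k + 1) → ℕ) : finMZV z s 0 = 0 := by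
  simp [finMZV]

lemma strictMono_snoc_iff {k : ℕ} {g : Fin k → ℕ} {n : ℕ} :
    StrictMono (Fin.snoc g n : Fin (k + 1) → ℕ) ↔ (∀ i, g i < n) ∧ StrictMono g := by
  constructor
  · intro h
    refine ⟨fun i => ?_, fun i j hij => ?_⟩
    · simpa using h (Fin.castSucc_lt_last i)
    · simpa using h (Fin.castSucc_lt_castSucc_iff.2 hij)
  · rintro ⟨hn, hm⟩ i j hij
    induction j using Fin.lastCases with
    | last =>
      induction i using Fin.lastCases with
      | last => exact absurd hij (lt_irrefl _)
      | cast i => simpa using hn i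
    | cast j =>
      induction i using Fin.lastCases with
      | last => exact absurd hij (not_lt.2 (Fin.le_last _))
      | cast i => simpa using hm (Fin.castSucc_lt_castSucc_iff.1 hij)

lemma strictTuples_succ_succ (k N : ℕ) :
    strictTuples (k + 1) (N + 1) = strictTuples (k + 1) N ∪
      (strictTuples k N).image (fun g => (Fin.snoc g N : Fin (k + 1) → ℕ)) := by
  ext f
  obtain ⟨g, n, rfl⟩ : ∃ (g : Fin k → ℕ) (n : ℕ), f = Fin.snoc g n :=
    ⟨Fin.init f, f (Fin.last k), (Fin.snoc_init_self f).symm⟩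
  simp only [Finset.mem_union, Finset.mem_image, mem_strictTuples, strictMono_snoc_iff,
    Fin.forall_fin_succ', Fin.snoc_castSucc, Fin.snoc_last]
  constructor
  · rintro ⟨⟨-, hn⟩, hg, hm⟩
    rcases Nat.lt_succ_iff_lt_or_eq.1 hn with h | rfl
    · exact Or.inl ⟨⟨fun i => (hg i).trans h, h⟩, hg, hm⟩
    · exact Or.inr ⟨g, ⟨hg, hm⟩, rfl⟩
  · rintro (⟨⟨h, hn⟩, hg, hm⟩ | ⟨g', ⟨hg, hm⟩, h⟩)
    · exact ⟨⟨fun i => (h i).trans (Nat.lt_succ_self N), hn.trans (Nat.lt_succ_self N)⟩, hg, hm⟩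
    · obtain ⟨rfl, rfl⟩ := Fin.snoc_inj.1 h
      exact ⟨⟨fun i => (hg i).trans (Nat.lt_succ_self _), Nat.lt_succ_self _⟩, hg, hm⟩

lemma finMZV_snoc_succ (z : ℝ) {k : ℕ} (s : Fin k → ℕ) (p N : ℕ) :
    finMZV z (Fin.snoc s p : Fin (k + 1) → ℕ) (N + 1) =
      finMZV z (Fin.snoc s p : Fin (k + 1) → ℕ) N + finMZV z s N / ((N : ℝ) + 1 + z) ^ p := by
  simp only [finMZV_eq_sum_strictTuples]
  rw [strictTuples_succ_succ, Finset.sum_union, Finset.sum_image]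
  · simp [Fin.prod_univ_castSucc, Finset.mul_sum, div_eq_mul_inv, mul_comm]
  · intro g _ g' _ h
    exact (Fin.snoc_inj.1 h).1
  · rw [Finset.disjoint_left]
    intro f hf hf'
    obtain ⟨g, -, rfl⟩ := Finset.mem_image.1 hf'
    simpa using (mem_strictTuples.1 hf).1 (Fin.last k)

lemma finMZV_snoc (z : ℝ) {k : ℕ} (s : Fin k → ℕ) (p N : ℕ) :
    finMZV z (Fin.snoc s p : Fin (k + 1) → ℕ) N =
      ∑ n ∈ Finset.range N, finMZV z s n / ((n : ℝ) + 1 + z) ^ p := by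
  induction N with
  | zero => simp [finMZV_succ_zero]
  | succ N ih => rw [finMZV_snoc_succ, ih, Finset.sum_range_succ]

lemma finMZV_nonneg {z : ℝ} (hz : -1 < z) {k : ℕ} (s : Fin k → ℕ) (N : ℕ) :
    0 ≤ finMZV z s N := by
  rw [finMZV_eq_sum_strictTuples]
  refine Finset.sum_nonneg fun f _ => Finset.prod_nonneg fun i _ => ?_
  have : 0 < (f i : ℝ) + 1 + z := by have := (f i).cast_nonneg (α := ℝ); linarith
  positivity

lemma summable_pi_prod {k : ℕ} {g : ℕ → ℝ} (hg : Summable g) (h0 : ∀ n, 0 ≤ g n) :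
    Summable fun f : Fin k → ℕ => ∏ i, g (f i) := by
  refine summable_of_sum_le (c := ∏ _i : Fin k, ∑' n, g n)
    (fun f => Finset.prod_nonneg fun i _ => h0 _) fun u => ?_
  calc ∑ f ∈ u, ∏ i, g (f i)
      ≤ ∑ f ∈ Fintype.piFinset fun i => u.image fun f => f i, ∏ i, g (f i) := by
        refine Finset.sum_le_sum_of_subset_of_nonneg (fun f hf => ?_)
          fun f _ _ => Finset.prod_nonneg fun i _ => h0 _
        exact Fintype.mem_piFinset.2 fun i => Finset.mem_image_of_mem _ hf
    _ = ∏ i : Fin k, ∑ n ∈ u.image fun f => f i, g n := (Finset.prod_univ_sum _ _).symm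
    _ ≤ ∏ _i : Fin k, ∑' n, g n := Finset.prod_le_prod
        (fun i _ => Finset.sum_nonneg fun n _ => h0 n)
        fun i _ => hg.sum_le_tsum _ fun n _ => h0 n

lemma one_div_pow_le {z : ℝ} (hz : z ∈ Set.Ioc (-1 : ℝ) 0) {m s : ℕ} (hms : m ≤ s) (n : ℕ) :
    1 / ((n : ℝ) + 1 + z) ^ s ≤ (1 / (1 + z)) ^ s * (((n : ℝ) + 1)⁻¹) ^ m := by
  have h1 : 0 < 1 + z := by linarith [hz.1]
  have hn : (0 : ℝ) ≤ n := n.cast_nonneg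
  have h2 : (1 + z) * ((n : ℝ) + 1) ≤ (n : ℝ) + 1 + z := by nlinarith [hz.2]
  calc 1 / ((n : ℝ) + 1 + z) ^ s ≤ 1 / ((1 + z) * ((n : ℝ) + 1)) ^ s := by gcongr
    _ = (1 / (1 + z)) ^ s * (((n : ℝ) + 1)⁻¹) ^ s := by
      rw [mul_pow, one_div_pow, inv_pow, one_div_mul_eq_div, one_div, mul_inv, div_eq_mul_inv,
        mul_comm]
    _ ≤ (1 / (1 + z)) ^ s * (((n : ℝ) + 1)⁻¹) ^ m := by
      gcongr ?_ * ?_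
      exact pow_le_pow_of_le_one (by positivity) (inv_le_one_of_one_le₀ (by linarith)) hms

/-- The series defining a multiple Hurwitz zeta value converges: for an increasing tuple, one of
the two factors `1 / n_k` can be spread evenly over all the indices. -/
lemma summable_MZV {z : ℝ} (hz : z ∈ Set.Ioc (-1 : ℝ) 0) {k : ℕ} {s : Fin (k + 1) → ℕ}
    (hs : ∀ i, 0 < s i) (hlast : 2 ≤ s (Fin.last k)) :
    Summable fun f : {f : Fin (k + 1) → ℕ // StrictMono f} =>
      ∏ i, 1 / ((f.1 i : ℝ) + 1 + z) ^ (s i) := by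
  have h1 : 0 < 1 + z := by linarith [hz.1]
  set e : ℝ := ((k + 1 : ℕ) : ℝ)⁻¹ with he
  have hepos : 0 < e := by positivity
  have hg : Summable fun n : ℕ => ((n : ℝ) + 1)⁻¹ * (((n : ℝ) + 1)⁻¹) ^ e := by
    have h := (summable_nat_add_iff 1).2
      (Real.summable_nat_rpow_inv.2 (by linarith : 1 < 1 + e))
    refine h.congr fun n => ?_
    have hn : (0 : ℝ) < (n : ℝ) + 1 := by positivity
    rw [Nat.cast_add_one, Real.rpow_add hn, Real.rpow_one, mul_inv, Real.inv_rpow hn.le]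
  have hsum := ((summable_pi_prod (k := k + 1) hg fun n => by positivity).subtype
    {f | StrictMono f}).mul_left (∏ i, (1 / (1 + z)) ^ s i)
  refine Summable.of_nonneg_of_le (fun f => Finset.prod_nonneg fun i _ => ?_) (fun f => ?_) hsum
  · have : 0 < (f.1 i : ℝ) + 1 + z := by have := (f.1 i).cast_nonneg (α := ℝ); linarith
    positivity
  obtain ⟨f, hf⟩ := f
  have hpow : ((f (Fin.last k) : ℝ) + 1)⁻¹ ≤ ∏ i, (((f i : ℝ) + 1)⁻¹) ^ e := by
    calc ((f (Fin.last k) : ℝ) + 1)⁻¹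
        = ∏ _i : Fin (k + 1), (((f (Fin.last k) : ℝ) + 1)⁻¹) ^ e := by
          rw [Finset.prod_const, Finset.card_univ, Fintype.card_fin, he,
            Real.rpow_inv_natCast_pow (by positivity) k.succ_ne_zero]
      _ ≤ ∏ i, (((f i : ℝ) + 1)⁻¹) ^ e := by
          gcongr with i
          exact hf.monotone (Fin.le_last i)
  calc ∏ i, 1 / ((f i : ℝ) + 1 + z) ^ (s i)
      ≤ ∏ i, (1 / (1 + z)) ^ s i * (((f i : ℝ) + 1)⁻¹) ^ (if i = Fin.last k then 2 else 1) := by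
        refine Finset.prod_le_prod (fun i _ => ?_) fun i _ => one_div_pow_le hz ?_ _
        · have : 0 < (f i : ℝ) + 1 + z := by have := (f i).cast_nonneg (α := ℝ); linarith
          positivity
        · split_ifs with h
          · exact h ▸ hlast
          · exact hs i
    _ = (∏ i, (1 / (1 + z)) ^ s i) *
          ((∏ i, ((f i : ℝ) + 1)⁻¹) * ((f (Fin.last k) : ℝ) + 1)⁻¹) := by
        rw [Finset.prod_mul_distrib, Fin.prod_univ_castSucc (fun i => (((f i : ℝ) + 1)⁻¹) ^ _),
          Fin.prod_univ_castSucc (fun i => ((f i : ℝ) + 1)⁻¹)]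
        simp [Fin.castSucc_ne_last, sq, mul_assoc]
    _ ≤ (∏ i, (1 / (1 + z)) ^ s i) *
          ((∏ i, ((f i : ℝ) + 1)⁻¹) * ∏ i, (((f i : ℝ) + 1)⁻¹) ^ e) := by
        gcongr
    _ = _ := by rw [← Finset.prod_mul_distrib]; rfl

lemma tendsto_finMZV {z : ℝ} {k : ℕ} {s : Fin k → ℕ}
    (h : Summable fun f : {f : Fin k → ℕ // StrictMono f} =>
      ∏ i, 1 / ((f.1 i : ℝ) + 1 + z) ^ (s i)) :
    Filter.Tendsto (finMZV z s) Filter.atTop (nhds (MZV z s)) := by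
  have hmono : Monotone fun N => (strictTuples k N).subtype StrictMono := by
    intro M N hMN f hf
    have hf := mem_strictTuples.1 (Finset.mem_subtype.1 hf)
    exact Finset.mem_subtype.2 (mem_strictTuples.2 ⟨fun i => (hf.1 i).trans_le hMN, hf.2⟩)
  have hex : ∀ f : {f : Fin k → ℕ // StrictMono f},
      ∃ N, f ∈ (strictTuples k N).subtype StrictMono := by
    intro f
    refine ⟨∑ i, f.1 i + 1, Finset.mem_subtype.2 (mem_strictTuples.2 ⟨fun i => ?_, f.2⟩)⟩
    exact Nat.lt_succ_of_le (Finset.single_le_sum (f := f.1) (fun _ _ => Nat.zero_le _)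
      (Finset.mem_univ i))
  refine (h.hasSum.comp (Filter.tendsto_atTop_finset_of_monotone hmono hex)).congr fun N => ?_
  rw [finMZV_eq_sum_strictTuples]
  exact Finset.sum_subtype_of_mem (fun f : Fin k → ℕ => ∏ i, 1 / ((f i : ℝ) + 1 + z) ^ (s i))
    fun f hf => (mem_strictTuples.1 hf).2

lemma hasSum_MZV_snoc {z : ℝ} (hz : z ∈ Set.Ioc (-1 : ℝ) 0) {k : ℕ} {s : Fin k → ℕ}
    (hs : ∀ i, 0 < s i) {p : ℕ} (hp : 2 ≤ p) :
    HasSum (fun n : ℕ => finMZV z s n / ((n : ℝ) + 1 + z) ^ p)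
      (MZV z (Fin.snoc s p : Fin (k + 1) → ℕ)) := by
  rw [hasSum_iff_tendsto_nat_of_nonneg]
  · refine (tendsto_finMZV (summable_MZV hz ?_ (by simpa using hp))).congr
      fun N => finMZV_snoc z s p N
    intro i
    induction i using Fin.lastCases with
    | last => simp only [Fin.snoc_last]; omega
    | cast i => simpa using hs i
  · intro n
    have : 0 < (n : ℝ) + 1 + z := by have := n.cast_nonneg (α := ℝ); linarith [hz.1]
    exact div_nonneg (finMZV_nonneg hz.1 s n) (by positivity)

/-- Theorem 4.1:
(a) `∑_{n≥1} ζ_n(s_1,…,s_k;z)/(n+z)^p = ζ(s_1,…,s_{k-1},s_k+p;z) + ζ(s_1,…,s_k,p;z)`, and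
(b) `∑_{n≥1} ζ_n(s_1,…,s_k;z)/(n+1+z)^p = ζ(s_1,…,s_k,p;z)`. -/
theorem eta_p_and_eta_zero_p (z : ℝ) (hz : z ∈ Set.Ioc (-1 : ℝ) 0)
    (p : ℕ) (hp : 2 ≤ p) {k : ℕ} (s : Fin (k + 1) → ℕ) (hs : ∀ i, 0 < s i) :
    (∑' n : ℕ, finMZV z s (n + 1) / ((n : ℝ) + 1 + z) ^ p =
        MZV z (Function.update s (Fin.last k) (s (Fin.last k) + p)) +
        MZV z (Fin.snoc s p)) ∧
    (∑' n : ℕ, finMZV z s (n + 1) / ((n : ℝ) + 1 + 1 + z) ^ p =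
        MZV z (Fin.snoc s p)) := by
  have hsnoc := hasSum_MZV_snoc hz hs hp
  constructor
  · have hinit : ∀ i, 0 < (Fin.init s : Fin k → ℕ) i := fun i => hs _
    have hupd := hasSum_MZV_snoc hz hinit (p := s (Fin.last k) + p) (by omega)
    have hsplit : Function.update s (Fin.last k) (s (Fin.last k) + p) =
        Fin.snoc (Fin.init s : Fin k → ℕ) (s (Fin.last k) + p) := by
      funext i
      induction i using Fin.lastCases with
      | last => simp
      | cast i => simp [Fin.castSucc_ne_last, Fin.init]
    rw [hsplit]
    refine ((hupd.add hsnoc).congr_fun fun n => ?_).tsum_eq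
    have hrec := finMZV_snoc_succ z (Fin.init s : Fin k → ℕ) (s (Fin.last k)) n
    rw [Fin.snoc_init_self] at hrec
    rw [hrec, add_div, div_div, ← pow_add, add_comm]
  · have h := (hasSum_nat_add_iff' 1).2 hsnoc
    simpa [finMZV_succ_zero] using h.tsum_eq
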